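/- arXiv:2512.17197 — 5 statements merged into one kernel-verified Lean document; each statement's English description precedes it below -/
import Mathlib

section
/- Let g : [0,∞) → ℝ be continuous with g(t) ≥ 0 for all t ≥ 0, let c₀ ≥ 0, and for μ̄ > 0 let c_{μ̄} : [0,∞) → ℝ be the differentiable function with c_{μ̄}(0) = c₀ and c_{μ̄}'(t) = g(t) - μ̄·c_{μ̄}(t) for all t ≥ 0. If 0 < μ̄₁ < μ̄₂, then c_{μ̄₁}(t) ≥ c_{μ̄₂}(t) for all t ≥ 0. -/
/-- Nonnegative data and forcing give nonnegative solutions. -/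
theorem linear_ode_nonneg (f h : ℝ → ℝ) (a : ℝ) (h0 : 0 ≤ f 0)
    (hh : ∀ t ≥ (0 : ℝ), 0 ≤ h t)
    (hf : ∀ t ≥ (0 : ℝ), HasDerivAt f (h t - a * f t) t) :
    ∀ t ≥ (0 : ℝ), 0 ≤ f t := by
  have hd : ∀ t ≥ (0 : ℝ),
      HasDerivAt (fun s => Real.exp (a * s) * f s) (Real.exp (a * t) * h t) t := by
    intro t ht
    have h1 : HasDerivAt (fun s : ℝ => Real.exp (a * s)) (Real.exp (a * t) * (a * 1)) t :=
      ((hasDerivAt_id t).const_mul a).exp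
    exact (h1.mul (hf t ht)).congr_deriv (by ring)
  have hm : MonotoneOn (fun s => Real.exp (a * s) * f s) (Set.Ici 0) := by
    apply monotoneOn_of_deriv_nonneg (convex_Ici 0)
    · exact fun t ht => (hd t ht).continuousAt.continuousWithinAt
    · exact fun t ht => (hd t (interior_subset ht)).differentiableAt.differentiableWithinAt
    · intro t ht
      rw [(hd t (interior_subset ht)).deriv]
      exact mul_nonneg (Real.exp_pos _).le (hh t (interior_subset ht))
  intro t ht
  have h2 := hm (Set.mem_Ici.2 le_rfl) (Set.mem_Ici.2 ht) ht
  simp only [mul_zero, Real.exp_zero, one_mul] at h2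
  exact nonneg_of_mul_nonneg_right (h0.trans h2) (Real.exp_pos _)

/-- Pointwise monotonicity in the decay rate for the scalar linear ODE `c' = g - μ̄ c`
with nonnegative forcing `g` and nonnegative initial data: if `0 < μ̄₁ < μ̄₂` then
`c_{μ̄₁}(t) ≥ c_{μ̄₂}(t)` for all `t ≥ 0`. -/
theorem coinfection_pointwise_monotone
    (g c₁ c₂ : ℝ → ℝ) (μ₁ μ₂ c₀ : ℝ)
    (hg : ContinuousOn g (Set.Ici 0))
    (hgpos : ∀ t ≥ (0 : ℝ), 0 ≤ g t)
    (hc₀ : 0 ≤ c₀)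
    (hμ₁ : 0 < μ₁) (hμ₁₂ : μ₁ < μ₂)
    (hc₁0 : c₁ 0 = c₀)
    (hc₂0 : c₂ 0 = c₀)
    (hode₁ : ∀ t ≥ (0 : ℝ), HasDerivAt c₁ (g t - μ₁ * c₁ t) t)
    (hode₂ : ∀ t ≥ (0 : ℝ), HasDerivAt c₂ (g t - μ₂ * c₂ t) t) :
    ∀ t ≥ (0 : ℝ), c₂ t ≤ c₁ t := by
  have h2 := linear_ode_nonneg c₂ g μ₂ (by rw [hc₂0]; exact hc₀) hgpos hode₂
  have h3 := linear_ode_nonneg (fun t => c₁ t - c₂ t) (fun t => (μ₂ - μ₁) * c₂ t) μ₁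
    (by simp [hc₁0, hc₂0])
    (fun t ht => mul_nonneg (sub_pos.2 hμ₁₂).le (h2 t ht))
    (fun t ht => ((hode₁ t ht).sub (hode₂ t ht)).congr_deriv (by ring))
  exact fun t ht => sub_nonneg.1 (h3 t ht)
end

section
/- Let g : [0,∞) → ℝ be continuous with g(t) ≥ 0 for all t ≥ 0, let c₀ > 0, and for μ̄ > 0 let c_{μ̄} : [0,∞) → ℝ be the differentiable function with c_{μ̄}(0) = c₀ and c_{μ̄}'(t) = g(t) - μ̄·c_{μ̄}(t) for all t ≥ 0. If 0 < μ̄₁ < μ̄₂, then c_{μ̄₁}(t) > c_{μ̄₂}(t) for all t > 0. -/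
/-- Strict pointwise monotonicity in the decay rate for the scalar linear ODE
`c' = g - μ̄ c` with nonnegative forcing `g` and positive initial data: if
`0 < μ̄₁ < μ̄₂` then `c_{μ̄₁}(t) > c_{μ̄₂}(t)` for all `t > 0`. -/
theorem coinfection_pointwise_strict_monotone
    (g c₁ c₂ : ℝ → ℝ) (μ₁ μ₂ c₀ : ℝ)
    (hg : ContinuousOn g (Set.Ici 0))
    (hgpos : ∀ t ≥ (0 : ℝ), 0 ≤ g t)
    (hc₀ : 0 < c₀)
    (hμ₁ : 0 < μ₁) (hμ₁₂ : μ₁ < μ₂)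
    (hc₁0 : c₁ 0 = c₀)
    (hc₂0 : c₂ 0 = c₀)
    (hode₁ : ∀ t ≥ (0 : ℝ), HasDerivAt c₁ (g t - μ₁ * c₁ t) t)
    (hode₂ : ∀ t ≥ (0 : ℝ), HasDerivAt c₂ (g t - μ₂ * c₂ t) t) :
    ∀ t > (0 : ℝ), c₂ t < c₁ t := by
  have hE : ∀ μ t : ℝ, HasDerivAt (fun x => Real.exp (μ * x)) (Real.exp (μ * t) * μ) t := by
    intro μ t
    simpa using ((hasDerivAt_id t).const_mul μ).exp
  have hd2 : ∀ t ≥ (0 : ℝ), HasDerivAt (fun x => c₂ x * Real.exp (μ₂ * x))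
      (g t * Real.exp (μ₂ * t)) t := by
    intro t ht
    refine ((hode₂ t ht).mul (hE μ₂ t)).congr_deriv ?_
    ring
  have hd : ∀ t ≥ (0 : ℝ), HasDerivAt (fun x => (c₁ x - c₂ x) * Real.exp (μ₁ * x))
      ((μ₂ - μ₁) * c₂ t * Real.exp (μ₁ * t)) t := by
    intro t ht
    refine (((hode₁ t ht).sub (hode₂ t ht)).mul (hE μ₁ t)).congr_deriv ?_
    simp only [Pi.sub_apply]
    ring
  have hmono : MonotoneOn (fun x => c₂ x * Real.exp (μ₂ * x)) (Set.Ici 0) := by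
    refine monotoneOn_of_deriv_nonneg (convex_Ici 0)
      (fun t ht => (hd2 t ht).continuousAt.continuousWithinAt)
      (fun t ht => (hd2 t (interior_subset ht)).differentiableAt.differentiableWithinAt) ?_
    intro t ht
    rw [(hd2 t (interior_subset ht)).deriv]
    exact mul_nonneg (hgpos t (interior_subset ht)) (Real.exp_pos _).le
  have hpos : ∀ t ≥ (0 : ℝ), 0 < c₂ t := by
    intro t ht
    have h := hmono (Set.mem_Ici.2 le_rfl) (Set.mem_Ici.2 ht) ht
    simp only [mul_zero, Real.exp_zero, mul_one, hc₂0] at h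
    exact pos_of_mul_pos_left (hc₀.trans_le h) (Real.exp_pos _).le
  have hstrict : StrictMonoOn (fun x => (c₁ x - c₂ x) * Real.exp (μ₁ * x)) (Set.Ici 0) := by
    refine strictMonoOn_of_deriv_pos (convex_Ici 0)
      (fun t ht => (hd t ht).continuousAt.continuousWithinAt) ?_
    intro t ht
    rw [(hd t (interior_subset ht)).deriv]
    exact mul_pos (mul_pos (sub_pos.2 hμ₁₂) (hpos t (interior_subset ht))) (Real.exp_pos _)
  intro t ht
  have h := hstrict (Set.mem_Ici.2 le_rfl) (Set.mem_Ici.2 ht.le) ht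
  simp only [hc₁0, hc₂0, sub_self, zero_mul] at h
  exact sub_pos.1 (pos_of_mul_pos_left h (Real.exp_pos _).le)
end

section
/- Let g : [0,∞) → ℝ be continuous with g(t) ≥ 0 for all t ≥ 0, let c₀ ≥ 0, and for μ̄ > 0 let c_{μ̄} : [0,∞) → ℝ be the differentiable function with c_{μ̄}(0) = c₀ and c_{μ̄}'(t) = g(t) - μ̄·c_{μ̄}(t) for all t ≥ 0. If 0 < μ̄₁ < μ̄₂, then for every T > 0 one has ∫₀ᵀ c_{μ̄₁}(t) dt ≥ ∫₀ᵀ c_{μ̄₂}(t) dt. -/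
/-- A solution of `h' = f - m h` with nonnegative data stays nonnegative. -/
theorem nonneg_of_linear_ode (f h : ℝ → ℝ) (m : ℝ) (hf : ∀ t ≥ (0 : ℝ), 0 ≤ f t)
    (h0 : 0 ≤ h 0) (hd : ∀ t ≥ (0 : ℝ), HasDerivAt h (f t - m * h t) t) :
    ∀ t ≥ (0 : ℝ), 0 ≤ h t := by
  intro t ht
  have hD : ∀ s ≥ (0 : ℝ),
      HasDerivAt (fun s => Real.exp (m * s) * h s) (Real.exp (m * s) * f s) s := by
    intro s hs
    have h1 : HasDerivAt (fun s : ℝ => Real.exp (m * s)) (Real.exp (m * s) * (m * 1)) s :=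
      ((hasDerivAt_id s).const_mul m).exp
    have h2 := h1.mul (hd s hs)
    refine h2.congr_deriv ?_
    ring
  have hm : MonotoneOn (fun s => Real.exp (m * s) * h s) (Set.Ici 0) := by
    apply monotoneOn_of_deriv_nonneg (convex_Ici 0)
    · intro s hs
      exact (hD s hs).continuousAt.continuousWithinAt
    · intro s hs
      exact (hD s (interior_subset hs)).differentiableAt.differentiableWithinAt
    · intro s hs
      rw [(hD s (interior_subset hs)).deriv]
      exact mul_nonneg (Real.exp_pos _).le (hf s (interior_subset hs))
  have h3 := hm (Set.mem_Ici.2 le_rfl) (Set.mem_Ici.2 ht) ht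
  simp only [mul_zero, Real.exp_zero, one_mul] at h3
  exact nonneg_of_mul_nonneg_right (h0.trans h3) (Real.exp_pos _)

/-- Integral monotonicity in the decay rate for the scalar linear ODE `c' = g - μ̄ c`
with nonnegative forcing `g` and nonnegative initial data: if `0 < μ̄₁ < μ̄₂` then for
every horizon `T > 0` the cumulative burden satisfies `∫₀ᵀ c_{μ̄₁} ≥ ∫₀ᵀ c_{μ̄₂}`. -/
theorem coinfection_cumulative_burden_monotone
    (g c₁ c₂ : ℝ → ℝ) (μ₁ μ₂ c₀ : ℝ)
    (hg : ContinuousOn g (Set.Ici 0))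
    (hgpos : ∀ t ≥ (0 : ℝ), 0 ≤ g t)
    (hc₀ : 0 ≤ c₀)
    (hμ₁ : 0 < μ₁) (hμ₁₂ : μ₁ < μ₂)
    (hc₁0 : c₁ 0 = c₀)
    (hc₂0 : c₂ 0 = c₀)
    (hode₁ : ∀ t ≥ (0 : ℝ), HasDerivAt c₁ (g t - μ₁ * c₁ t) t)
    (hode₂ : ∀ t ≥ (0 : ℝ), HasDerivAt c₂ (g t - μ₂ * c₂ t) t) :
    ∀ T > (0 : ℝ), (∫ t in (0 : ℝ)..T, c₂ t) ≤ ∫ t in (0 : ℝ)..T, c₁ t := by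
  intro T hT
  have hp := nonneg_of_linear_ode g c₂ μ₂ hgpos (by rw [hc₂0]; exact hc₀) hode₂
  have hq := nonneg_of_linear_ode (fun t => (μ₂ - μ₁) * c₂ t) (fun t => c₁ t - c₂ t) μ₁
    (fun t ht => mul_nonneg (sub_pos.2 hμ₁₂).le (hp t ht)) (by simp [hc₁0, hc₂0])
    (fun t ht => ((hode₁ t ht).sub (hode₂ t ht)).congr_deriv (by ring))
  apply intervalIntegral.integral_mono_on hT.le
  · apply ContinuousOn.intervalIntegrable_of_Icc hT.le
    exact fun t ht => (hode₂ t ht.1).continuousAt.continuousWithinAt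
  · apply ContinuousOn.intervalIntegrable_of_Icc hT.le
    exact fun t ht => (hode₁ t ht.1).continuousAt.continuousWithinAt
  · intro t ht
    exact sub_nonneg.1 (hq t ht.1)
end

section
/- Let μ̄ > 0, let t₀ ≥ 0, let ε > 0, let c : [t₀,∞) → ℝ be differentiable with c(t) ≥ 0 and c'(t) ≥ -μ̄·c(t) for all t ≥ t₀ and c(t₀) > ε, and let J : [t₀,∞) → ℝ satisfy J(t) ≥ c(t) for all t ≥ t₀. Define T_J(ε) = inf { t ≥ t₀ : J(t) < ε } and T_c(ε) = inf { t ≥ t₀ : c(t) < ε } (with infimum of the empty set equal to +∞). Then T_J(ε) ≥ T_c(ε) ≥ t₀ + (1/μ̄)·ln(c(t₀)/ε). -/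
/-- Lower bound on the epidemic duration: with
`T_c(ε) = inf { t ≥ t₀ : c t < ε }` and `T_J(ε) = inf { t ≥ t₀ : J t < ε }`
(computed in `EReal`, so that the infimum of the empty set is `+∞`), if `c ≥ 0`,
`c' ≥ -μ̄ c` on `[t₀,∞)`, `c(t₀) > ε` and `J ≥ c` on `[t₀,∞)`, then
`T_J(ε) ≥ T_c(ε) ≥ t₀ + (1/μ̄) ln(c(t₀)/ε)`. -/
theorem epidemic_duration_lower_bound
    (μbar t₀ ε : ℝ) (c J : ℝ → ℝ)
    (hμ : 0 < μbar)
    (ht₀ : 0 ≤ t₀)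
    (hε : 0 < ε)
    (hnonneg : ∀ t ≥ t₀, 0 ≤ c t)
    (hdiff : ∀ t ≥ t₀, DifferentiableAt ℝ c t)
    (hineq : ∀ t ≥ t₀, -μbar * c t ≤ deriv c t)
    (hstart : ε < c t₀)
    (hJc : ∀ t ≥ t₀, c t ≤ J t) :
    ((t₀ + (1 / μbar) * Real.log (c t₀ / ε) : ℝ) : EReal)
        ≤ sInf {x : EReal | ∃ t : ℝ, t₀ ≤ t ∧ c t < ε ∧ x = (t : EReal)}
      ∧ sInf {x : EReal | ∃ t : ℝ, t₀ ≤ t ∧ c t < ε ∧ x = (t : EReal)}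
        ≤ sInf {x : EReal | ∃ t : ℝ, t₀ ≤ t ∧ J t < ε ∧ x = (t : EReal)} := by
  have hd : ∀ t ≥ t₀, HasDerivAt (fun s => c s * Real.exp (μbar * s))
      (deriv c t * Real.exp (μbar * t) + c t * (Real.exp (μbar * t) * μbar)) t := by
    intro t ht
    have h1 : HasDerivAt (fun s : ℝ => μbar * s) μbar t := by
      simpa using (hasDerivAt_id t).const_mul μbar
    exact (hdiff t ht).hasDerivAt.mul h1.exp
  have hmono : MonotoneOn (fun s => c s * Real.exp (μbar * s)) (Set.Ici t₀) := by
    apply monotoneOn_of_deriv_nonneg (convex_Ici t₀)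
    · intro t ht
      exact (hd t ht).continuousAt.continuousWithinAt
    · intro t ht
      exact (hd t (interior_subset ht)).differentiableAt.differentiableWithinAt
    · intro t ht
      have ht' : t ≥ t₀ := interior_subset ht
      rw [(hd t ht').deriv]
      have h1 := hineq t ht'
      have h2 : 0 ≤ (deriv c t + μbar * c t) * Real.exp (μbar * t) :=
        mul_nonneg (by linarith) (Real.exp_pos _).le
      linarith
  constructor
  · apply le_sInf
    rintro x ⟨t, ht, hct, rfl⟩
    rw [EReal.coe_le_coe_iff]
    have h1 : c t₀ * Real.exp (μbar * t₀) ≤ c t * Real.exp (μbar * t) :=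
      hmono (Set.mem_Ici.2 le_rfl) (Set.mem_Ici.2 ht) ht
    have h2 : c t * Real.exp (μbar * t) ≤ ε * Real.exp (μbar * t) :=
      mul_le_mul_of_nonneg_right hct.le (Real.exp_pos _).le
    have hc0 : 0 < c t₀ := hε.trans hstart
    have h3 := Real.log_le_log (mul_pos hc0 (Real.exp_pos _)) (h1.trans h2)
    rw [Real.log_mul hc0.ne' (Real.exp_pos _).ne', Real.log_mul hε.ne' (Real.exp_pos _).ne',
      Real.log_exp, Real.log_exp] at h3
    rw [Real.log_div hc0.ne' hε.ne']
    have h4 : 1 / μbar * (Real.log (c t₀) - Real.log ε) ≤ t - t₀ := by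
      rw [one_div, inv_mul_le_iff₀ hμ]
      linarith
    linarith
  · apply sInf_le_sInf
    rintro x ⟨t, ht, hJ, rfl⟩
    exact ⟨t, ht, (hJc t ht).trans_lt hJ, rfl⟩
end

section
/- Let k, λ, μ, μ̄ be real numbers, let T > 0, and let x_ss, x_is, x_rs, x_si, x_ii, x_ri, x_sr, x_ir, x_rr : [0,T] → ℝ be bounded differentiable functions solving the nine-compartment symbiotic SIR system with equal transmission rates λ₁ = λ₂ = λ (as in the exchange-symmetry statement). If the initial conditions satisfy x_is(0) = x_si(0), x_rs(0) = x_sr(0), and x_ri(0) = x_ir(0), then x_is(t) = x_si(t), x_rs(t) = x_sr(t), and x_ri(t) = x_ir(t) for all t ∈ [0,T]. -/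
/-- The nine-compartment mean-field symbiotic SIR system on the time interval `[0,T]`,
with transmission rates `λ₁, λ₂`, single-infection recovery rate `μ`, co-infection
recovery rate `μ̄`, and prevalences `i_A = x_is + x_ii + x_ir`,
`i_B = x_si + x_ii + x_ri`. -/
def SolvesSymbioticSIROn (k l1 l2 m mb T : ℝ)
    (xss xis xrs xsi xii xri xsr xir xrr : ℝ → ℝ) : Prop :=
  (∀ t ∈ Set.Icc (0 : ℝ) T, HasDerivAt xss
    (-(k * l1) * xss t * (xis t + xii t + xir t)
      - (k * l2) * xss t * (xsi t + xii t + xri t)) t) ∧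
  (∀ t ∈ Set.Icc (0 : ℝ) T, HasDerivAt xis
    (-(m * xis t) - (k * l2) * xis t * (xsi t + xii t + xri t)
      + (k * l1) * xss t * (xis t + xii t + xir t)) t) ∧
  (∀ t ∈ Set.Icc (0 : ℝ) T, HasDerivAt xrs
    (m * xis t - (k * l2) * xrs t * (xsi t + xii t + xri t)) t) ∧
  (∀ t ∈ Set.Icc (0 : ℝ) T, HasDerivAt xsi
    (-(k * l1) * xsi t * (xis t + xii t + xir t) - m * xsi t
      + (k * l2) * xss t * (xsi t + xii t + xri t)) t) ∧
  (∀ t ∈ Set.Icc (0 : ℝ) T, HasDerivAt xii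
    ((k * l1) * xsi t * (xis t + xii t + xir t)
      + (k * l2) * xis t * (xsi t + xii t + xri t) - mb * xii t) t) ∧
  (∀ t ∈ Set.Icc (0 : ℝ) T, HasDerivAt xri
    ((k * l2) * xrs t * (xsi t + xii t + xri t) - m * xri t) t) ∧
  (∀ t ∈ Set.Icc (0 : ℝ) T, HasDerivAt xsr
    (-(k * l1) * xsr t * (xis t + xii t + xir t) + m * xsi t) t) ∧
  (∀ t ∈ Set.Icc (0 : ℝ) T, HasDerivAt xir
    ((k * l1) * xsr t * (xis t + xii t + xir t) - m * xir t) t) ∧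
  (∀ t ∈ Set.Icc (0 : ℝ) T, HasDerivAt xrr
    (mb * xii t + m * xir t + m * xri t) t)

/-- Norm bound for the right-hand side of the linear system satisfied by the differences. -/
theorem symSIR_bound {k l m C N ss is rs si ii ri sr ir : ℝ}
    (b1 : |ss| ≤ C) (b4 : |si| ≤ C) (b5 : |ii| ≤ C) (b6 : |ri| ≤ C) (b7 : |sr| ≤ C)
    (hu : |is - si| ≤ N) (hv : |rs - sr| ≤ N) (hw : |ri - ir| ≤ N) :
    ‖((-(m * is) - (k * l) * is * (si + ii + ri) + (k * l) * ss * (is + ii + ir))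
        - (-(k * l) * si * (is + ii + ir) - m * si + (k * l) * ss * (si + ii + ri)),
      (m * is - (k * l) * rs * (si + ii + ri)) - (-(k * l) * sr * (is + ii + ir) + m * si),
      ((k * l) * rs * (si + ii + ri) - m * ri) - ((k * l) * sr * (is + ii + ir) - m * ir))‖
      ≤ (|m| + 7 * (|k * l| * C)) * N := by
  have hN : 0 ≤ N := (abs_nonneg _).trans hu
  have hC : 0 ≤ C := (abs_nonneg _).trans b1
  have hB : |si + ii + ri| ≤ 3 * C := by
    rw [abs_le] at *; constructor <;> linarith
  have hD : |(is - si) - (ri - ir)| ≤ 2 * N := by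
    rw [abs_le] at *; constructor <;> linarith
  have mulb : ∀ {a b P Q : ℝ}, |a| ≤ P → |b| ≤ Q → |a * b| ≤ P * Q := by
    intro a b P Q h h'
    rw [abs_mul]
    exact mul_le_mul h h' (abs_nonneg _) ((abs_nonneg _).trans h)
  have q : |k * l| ≤ |k * l| := le_rfl
  have p : |m| ≤ |m| := le_rfl
  have e1 := abs_le.1 (mulb q (mulb hu hB))
  have e2 := abs_le.1 (mulb q (mulb hv hB))
  have e3 := abs_le.1 (mulb q (mulb b4 hD))
  have e4 := abs_le.1 (mulb q (mulb b1 hD))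
  have e5 := abs_le.1 (mulb q (mulb b7 hD))
  have e6 := abs_le.1 (mulb p hu)
  have e7 := abs_le.1 (mulb p hw)
  have e0 : 0 ≤ |k * l| * C * N := by positivity
  refine norm_prod_le_iff.2 ⟨?_, norm_prod_le_iff.2 ⟨?_, ?_⟩⟩ <;>
    rw [Real.norm_eq_abs, abs_le] <;> constructor <;> dsimp only <;> linarith

/-- Persistence of the exchange symmetry: a bounded solution of the symbiotic SIR
system with equal transmission rates and exchange-symmetric initial data
(`x_is(0) = x_si(0)`, `x_rs(0) = x_sr(0)`, `x_ri(0) = x_ir(0)`) remains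
exchange-symmetric on all of `[0,T]`. -/
theorem symbiotic_SIR_symmetry_persists
    (k l m mb T : ℝ) (hT : 0 < T)
    (xss xis xrs xsi xii xri xsr xir xrr : ℝ → ℝ)
    (hsol : SolvesSymbioticSIROn k l l m mb T xss xis xrs xsi xii xri xsr xir xrr)
    (hbdd : ∃ C, ∀ t ∈ Set.Icc (0 : ℝ) T,
      |xss t| ≤ C ∧ |xis t| ≤ C ∧ |xrs t| ≤ C ∧ |xsi t| ≤ C ∧ |xii t| ≤ C ∧
      |xri t| ≤ C ∧ |xsr t| ≤ C ∧ |xir t| ≤ C ∧ |xrr t| ≤ C)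
    (h1 : xis 0 = xsi 0) (h2 : xrs 0 = xsr 0) (h3 : xri 0 = xir 0) :
    ∀ t ∈ Set.Icc (0 : ℝ) T, xis t = xsi t ∧ xrs t = xsr t ∧ xri t = xir t := by
  obtain ⟨C, hC⟩ := hbdd
  obtain ⟨-, his, hrs, hsi, -, hri, hsr, hir, -⟩ := hsol
  have hd : ∀ t ∈ Set.Icc (0 : ℝ) T, HasDerivAt
      (fun t => (xis t - xsi t, xrs t - xsr t, xri t - xir t)) _ t := fun t ht =>
    ((his t ht).sub (hsi t ht)).prodMk
      (((hrs t ht).sub (hsr t ht)).prodMk ((hri t ht).sub (hir t ht)))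
  have key := eq_zero_of_abs_deriv_le_mul_abs_self_of_eq_zero_right
    (K := |m| + 7 * (|k * l| * C))
    (fun t ht => (hd t ht).continuousAt.continuousWithinAt)
    (fun t ht => (hd t (Set.Ico_subset_Icc_self ht)).hasDerivWithinAt)
    (by simp [h1, h2, h3])
    (by
      intro t ht
      obtain ⟨b1, b2, b3, b4, b5, b6, b7, b8, -⟩ := hC t (Set.Ico_subset_Icc_self ht)
      set N := ‖(xis t - xsi t, xrs t - xsr t, xri t - xir t)‖ with hN
      have hu : |xis t - xsi t| ≤ N := norm_fst_le (xis t - xsi t, xrs t - xsr t, xri t - xir t)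
      have hvw : ‖(xrs t - xsr t, xri t - xir t)‖ ≤ N :=
        norm_snd_le (xis t - xsi t, xrs t - xsr t, xri t - xir t)
      have hv : |xrs t - xsr t| ≤ N :=
        (norm_fst_le (xrs t - xsr t, xri t - xir t)).trans hvw
      have hw : |xri t - xir t| ≤ N :=
        (norm_snd_le (xrs t - xsr t, xri t - xir t)).trans hvw
      exact symSIR_bound b1 b4 b5 b6 b7 hu hv hw)
  intro t ht
  have h := key t ht
  simp only [Prod.mk_eq_zero, sub_eq_zero] at h
  exact h
end
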